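/- Let T be a torus with dual lattice Λ⁰ = Hom(T, ℝ/ℤ) ≅ ℤ^r, and for a closed subgroup S ≤ T let Λ^S = ker(Λ⁰ → S*) be the corresponding sublattice. For any nonzero lattice Λ ≤ ℤ^r let μ(Λ) be the minimal sup-norm of a nonzero element. Then a sequence of closed subgroups S_n ≤ T converges to T in the Hausdorff metric if and only if μ(Λ^{S_n}) → ∞. -/

import Mathlib

open Filter

/-- The annihilator lattice `Λ^S ≤ ℤ^r` of a subgroup `S` of the torus
`T = (ℝ/ℤ)^r` under Pontrjagin duality. -/
def dualLattice {r : ℕ} (S : AddSubgroup (Fin r → AddCircle (1 : ℝ))) :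
    Set (Fin r → ℤ) :=
  {v | ∀ x ∈ S, (∑ i, v i • x i) = 0}

section Helpers
open MeasureTheory UnitAddTorus

lemma exists_half {r : ℕ} (v : Fin r → ℤ) (hv : v ≠ 0) :
    ∃ x : Fin r → AddCircle (1 : ℝ), (∑ i, v i • x i) = (((1 : ℝ) / 2 : ℝ) : AddCircle (1 : ℝ)) := by
  obtain ⟨i, hi⟩ := Function.ne_iff.mp hv
  refine ⟨Pi.single i (((1 / 2 / (v i : ℝ)) : ℝ) : AddCircle (1 : ℝ)), ?_⟩
  rw [Finset.sum_eq_single i]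
  · have hi' : (v i : ℝ) ≠ 0 := by exact_mod_cast hi
    rw [Pi.single_eq_same, ← AddCircle.coe_zsmul, zsmul_eq_mul]
    congr 1
    field_simp
  · intro j _ hj
    simp [hj]
  · simp

lemma norm_half : ‖(((1 : ℝ) / 2 : ℝ) : AddCircle (1 : ℝ))‖ = 1 / 2 := by
  rw [AddCircle.norm_half_period_eq]; simp

lemma mFourier_eq {r : ℕ} (v : Fin r → ℤ) (x : Fin r → AddCircle (1 : ℝ)) :
    mFourier v x = (AddCircle.toCircle (∑ i, v i • x i) : ℂ) := by
  have h : ∀ s : Finset (Fin r), (AddCircle.toCircle (∑ i ∈ s, v i • x i) : ℂ)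
      = ∏ i ∈ s, fourier (v i) (x i) := by
    intro s
    induction s using Finset.induction_on with
    | empty => simp
    | insert a s ha ih =>
      rw [Finset.sum_insert ha, Finset.prod_insert ha, AddCircle.toCircle_add, Circle.coe_mul, ih,
        fourier_apply]
  rw [h]; rfl

lemma mFourier_map_add {r : ℕ} (v : Fin r → ℤ) (x y : Fin r → AddCircle (1 : ℝ)) :
    mFourier v (x + y) = mFourier v x * mFourier v y := by
  simp only [mFourier_eq, ← Circle.coe_mul, ← AddCircle.toCircle_add, ← Finset.sum_add_distrib,
    Pi.add_apply, smul_add]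

lemma mFourier_eq_one {r : ℕ} (v : Fin r → ℤ) (x : Fin r → AddCircle (1 : ℝ))
    (h : mFourier v x = 1) : (∑ i, v i • x i) = 0 := by
  rw [mFourier_eq] at h
  apply AddCircle.injective_toCircle (T := (1 : ℝ)) one_ne_zero
  rw [AddCircle.toCircle_zero]
  exact Circle.ext (by simpa using h)

lemma integral_char {r : ℕ} {G : Type*} [AddGroup G] [MeasurableSpace G] [MeasurableAdd G]
    (μ : Measure G) [μ.IsAddLeftInvariant] (φ : G →+ (Fin r → AddCircle (1 : ℝ)))
    (v : Fin r → ℤ) (g : G) (hg : (∑ i, v i • φ g i) ≠ 0) :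
    ∫ x, mFourier v (φ x) ∂μ = 0 := by
  have h := integral_add_left_eq_self (μ := μ) (fun x => mFourier v (φ x)) g
  simp only [map_add, mFourier_map_add] at h
  rw [integral_const_mul] at h
  have hne : mFourier v (φ g) ≠ 1 := fun h1 => hg (mFourier_eq_one _ _ h1)
  have : (mFourier v (φ g) - 1) * ∫ x, mFourier v (φ x) ∂μ = 0 := by
    rw [sub_mul, h]; simp
  exact (mul_eq_zero.mp this).resolve_left (sub_ne_zero.mpr hne)

lemma integral_span {r : ℕ} (m : Measure (Fin r → AddCircle (1 : ℝ)))
    [IsProbabilityMeasure m] [m.IsAddLeftInvariant]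
    (p : C(UnitAddTorus (Fin r), ℂ)) (hp : p ∈ Submodule.span ℂ (Set.range (mFourier (d := Fin r)))) :
    ∃ N : ℕ, ∀ S : AddSubgroup (Fin r → AddCircle (1 : ℝ)),
      IsClosed (S : Set (Fin r → AddCircle (1 : ℝ))) →
      (∀ v ∈ dualLattice S, v ≠ 0 → ∃ i, (N : ℤ) ≤ |v i|) →
      ∀ μ : Measure S, IsProbabilityMeasure μ → μ.IsAddLeftInvariant →
      ∫ x : S, p x ∂μ = ∫ x, p x ∂m := by
  induction hp using Submodule.span_induction with
  | mem p hp =>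
    obtain ⟨v, rfl⟩ := hp
    by_cases hv : v = 0
    · subst hv
      refine ⟨0, fun S _ _ μ _ _ => ?_⟩
      simp [mFourier_zero]
    · refine ⟨∑ i, (v i).natAbs + 1, fun S _ h μ _ _ => ?_⟩
      obtain ⟨x, hx⟩ := exists_half v hv
      have h2 : ∫ x, mFourier v x ∂m = 0 := by
        refine integral_char m (AddMonoidHom.id _) v x ?_
        intro h0
        have h3 := norm_half
        rw [← hx] at h3
        simp only [AddMonoidHom.id_apply] at h0
        rw [h0] at h3
        norm_num at h3
      rw [h2]
      have hnot : v ∉ dualLattice S := by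
        intro hmem
        obtain ⟨i, hi⟩ := h v hmem hv
        have := Finset.single_le_sum (f := fun i => (v i).natAbs) (fun i _ => Nat.zero_le _)
          (Finset.mem_univ i)
        rw [Int.abs_eq_natAbs] at hi
        omega
      simp only [dualLattice, Set.mem_ofPred_eq, not_forall] at hnot
      obtain ⟨y, hy, hne⟩ := hnot
      exact integral_char μ S.subtype v ⟨y, hy⟩ hne
  | zero => exact ⟨0, fun S _ _ μ _ _ => by simp⟩
  | add p q _ _ ihp ihq =>
    obtain ⟨N, hN⟩ := ihp
    obtain ⟨M, hM⟩ := ihq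
    refine ⟨max N M, fun S hS h μ _ _ => ?_⟩
    have : CompactSpace S := isCompact_iff_compactSpace.mp hS.isCompact
    have i1 : ∀ p : C(UnitAddTorus (Fin r), ℂ), Integrable (fun x : S => p x) μ := fun p =>
      (p.continuous.comp continuous_subtype_val).integrable_of_hasCompactSupport
        (HasCompactSupport.of_compactSpace _)
    have i2 : ∀ p : C(UnitAddTorus (Fin r), ℂ), Integrable (fun x => p x) m := fun p =>
      p.continuous.integrable_of_hasCompactSupport (HasCompactSupport.of_compactSpace _)
    simp only [ContinuousMap.add_apply]
    rw [integral_add (i1 p) (i1 q), integral_add (i2 p) (i2 q),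
      hN S hS (fun v hv h0 => (h v hv h0).imp fun i hi => by omega) μ ‹_› ‹_›,
      hM S hS (fun v hv h0 => (h v hv h0).imp fun i hi => by omega) μ ‹_› ‹_›]
  | smul a p _ ihp =>
    obtain ⟨N, hN⟩ := ihp
    refine ⟨N, fun S hS h μ _ _ => ?_⟩
    simp only [ContinuousMap.smul_apply]
    rw [integral_smul, integral_smul, hN S hS h μ ‹_› ‹_›]

lemma exists_mem_ball {r : ℕ} (x : Fin r → AddCircle (1 : ℝ)) (ε : ℝ) (hε : 0 < ε) :
    ∃ N : ℕ, ∀ S : AddSubgroup (Fin r → AddCircle (1 : ℝ)),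
      IsClosed (S : Set (Fin r → AddCircle (1 : ℝ))) →
      (∀ v ∈ dualLattice S, v ≠ 0 → ∃ i, (N : ℤ) ≤ |v i|) →
      ∃ s ∈ S, dist x s < ε := by
  let m : Measure (Fin r → AddCircle (1 : ℝ)) := Measure.addHaarMeasure ⊤
  have : IsProbabilityMeasure m := ⟨Measure.addHaarMeasure_self⟩
  let f : C(UnitAddTorus (Fin r), ℝ) := ⟨fun y => max 0 (ε - dist x y), by fun_prop⟩
  have hfpos : 0 < ∫ y, f y ∂m := by
    refine f.continuous.integral_pos_of_hasCompactSupport_nonneg_nonzero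
      (HasCompactSupport.of_compactSpace _) (fun y => le_max_left _ _) (x := x) ?_
    simp [f, hε.le, hε.ne']
  set c := ∫ y, f y ∂m with hc
  let F : C(UnitAddTorus (Fin r), ℂ) := ⟨fun y => (f y : ℂ), by fun_prop⟩
  have hF : F ∈ closure (Submodule.span ℂ (Set.range (mFourier (d := Fin r))) : Set _) := by
    rw [← Submodule.topologicalClosure_coe, span_mFourier_closure_eq_top]; trivial
  obtain ⟨p, hp, hFp⟩ := Metric.mem_closure_iff.mp hF (c / 2) (by positivity)
  obtain ⟨N, hN⟩ := integral_span m p hp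
  refine ⟨N, fun S hS h => ?_⟩
  by_contra! hcon
  have : CompactSpace S := isCompact_iff_compactSpace.mp hS.isCompact
  let μ : Measure S := Measure.addHaarMeasure ⊤
  have : IsProbabilityMeasure μ := ⟨Measure.addHaarMeasure_self⟩
  have key := hN S hS h μ inferInstance inferInstance
  have hpt : ∀ y, ‖F y - p y‖ ≤ dist F p := fun y => by
    rw [← dist_eq_norm]; exact ContinuousMap.dist_apply_le_dist y
  have b1 : ‖∫ y : S, p y ∂μ‖ ≤ dist F p := by
    have := norm_integral_le_of_norm_le_const (μ := μ) (f := fun y : S => p y) (C := dist F p)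
      (ae_of_all _ fun y => by
        have h1 := hpt y
        have h2 : F y = 0 := by
          have := hcon y y.2
          simp only [F, f, ContinuousMap.coe_mk, Complex.ofReal_eq_zero]
          exact max_eq_left (by linarith)
        rwa [h2, zero_sub, norm_neg] at h1)
    simpa using this
  have i2 : ∀ p : C(UnitAddTorus (Fin r), ℂ), Integrable (fun x => p x) m := fun p =>
      p.continuous.integrable_of_hasCompactSupport (HasCompactSupport.of_compactSpace _)
  have b2 : ‖∫ y, (F y - p y) ∂m‖ ≤ dist F p := by
    simpa using norm_integral_le_of_norm_le_const (μ := m) (f := fun y => F y - p y)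
      (C := dist F p) (ae_of_all _ hpt)
  rw [integral_sub (i2 F) (i2 p), ← key] at b2
  have hFc : ∫ y, F y ∂m = (c : ℂ) := integral_ofReal
  have h3 : ‖(c : ℂ)‖ = c := by simp [abs_of_pos hfpos]
  have := norm_sub_norm_le (∫ y, F y ∂m) (∫ y : S, p y ∂μ)
  rw [hFc] at this b2
  linarith

end Helpers

/-- A sequence of closed subgroups `Sₙ ≤ T = (ℝ/ℤ)^r` converges to `T` in the
Hausdorff metric if and only if `μ(Λ^{Sₙ}) → ∞`, where `μ(Λ)` is the minimal
sup-norm of a nonzero element of the dual lattice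
`Λ^S = { v ∈ ℤ^r : ∑ vᵢ·xᵢ = 0 for all x ∈ S }`. -/
theorem tendsto_top_iff_dualLattice_min_norm_tendsto_atTop
    (r : ℕ) (S : ℕ → AddSubgroup (Fin r → AddCircle (1 : ℝ)))
    (hScl : ∀ n, IsClosed (S n : Set (Fin r → AddCircle (1 : ℝ)))) :
    Tendsto (fun n => Metric.hausdorffDist (S n : Set (Fin r → AddCircle (1 : ℝ)))
        Set.univ) atTop (nhds 0) ↔
      ∀ N : ℕ, ∀ᶠ n in atTop,
        ∀ v ∈ dualLattice (S n), v ≠ 0 → ∃ i, (N : ℤ) ≤ |v i| := by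
  have fin : ∀ n, Metric.hausdorffEDist (S n : Set (Fin r → AddCircle (1 : ℝ))) Set.univ ≠ ⊤ :=
    fun n => Metric.hausdorffEDist_ne_top_of_nonempty_of_bounded ⟨0, (S n).zero_mem⟩
      Set.univ_nonempty (hScl n).isCompact.isBounded isCompact_univ.isBounded
  constructor
  · intro h N
    have hε : (0 : ℝ) < 1 / (2 * (r * N + 1)) := by positivity
    filter_upwards [h.eventually (gt_mem_nhds hε)] with n hn v hv hv0
    by_contra! hcon
    obtain ⟨x, hx⟩ := exists_half v hv0
    obtain ⟨s, hs, hd⟩ := Metric.exists_dist_lt_of_hausdorffDist_lt' (Set.mem_univ x) hn (fin n)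
    have h0 := hv s hs
    have h1 : ∑ i, v i • (s i - x i) = -(((1 : ℝ) / 2 : ℝ) : AddCircle (1 : ℝ)) := by
      simp only [smul_sub, Finset.sum_sub_distrib, h0, hx, zero_sub]
    have h2 : ‖∑ i, v i • (s i - x i)‖ ≤ ∑ i : Fin r, (N : ℝ) * (1 / (2 * (r * N + 1))) := by
      refine (norm_sum_le _ _).trans (Finset.sum_le_sum fun i _ => ?_)
      refine (norm_zsmul_le _ _).trans ?_
      gcongr
      · rw [Int.norm_eq_abs]
        exact_mod_cast (hcon i).le
      · rw [← dist_eq_norm]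
        exact (dist_le_pi_dist s x i).trans hd.le
    rw [h1, norm_neg, norm_half] at h2
    simp only [Finset.sum_const, Finset.card_univ, Fintype.card_fin, nsmul_eq_mul] at h2
    have h3 : (r : ℝ) * (N * (1 / (2 * (r * N + 1)))) < 1 / 2 := by
      have : (0 : ℝ) < r * N + 1 := by positivity
      field_simp
      linarith
    linarith
  · intro h
    rw [Metric.tendsto_nhds]
    intro ε hε
    obtain ⟨t, -, htf, ht⟩ := Metric.totallyBounded_iff.mp
      (isCompact_univ (X := Fin r → AddCircle (1 : ℝ))).totallyBounded (ε / 4) (by positivity)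
      |>.imp fun t ht => (⟨trivial, ht.1, ht.2⟩ : True ∧ _ ∧ _)
    have hev : ∀ᶠ n in atTop, ∀ x ∈ t, ∃ s ∈ S n, dist x s < ε / 4 := by
      rw [htf.eventually_all]
      intro x _
      obtain ⟨N, hN⟩ := exists_mem_ball x (ε / 4) (by positivity)
      filter_upwards [h N] with n hn using hN (S n) (hScl n) hn
    filter_upwards [hev] with n hn
    rw [Real.dist_0_eq_abs, abs_of_nonneg Metric.hausdorffDist_nonneg]
    refine lt_of_le_of_lt (Metric.hausdorffDist_le_of_mem_dist (r := ε / 2) (by positivity)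
      (fun x _ => ⟨x, trivial, by simp; positivity⟩) fun y _ => ?_) (half_lt_self hε)
    obtain ⟨x, hx, hy⟩ := Set.mem_iUnion₂.mp (ht (Set.mem_univ y))
    obtain ⟨s, hs, hd⟩ := hn x hx
    refine ⟨s, hs, ?_⟩
    have := dist_triangle y x s
    rw [Metric.mem_ball] at hy
    linarith
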